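/- arXiv:1906.01715 — 2 statements merged into one kernel-verified Lean document; each statement's English description precedes it below -/
import Mathlib

section
/- Let K̂ ⊂ ℝ^d be a reference generalized prism and, for ε > 0, define K̂_ε := K̂ ∩ (K̂ − ε e_d), where e_d is the d-th standard basis vector. Then for every p ≥ 1, every real polynomial v of total degree at most p in d variables, and every ε > 0, ∫_{K̂ ∖ K̂_ε} v² dx ≤ 32 ε p² ∫_{K̂} v² dx. -/
open MeasureTheory

/-- The closed unit cube `[0,1]^k` in `ℝ^k` (as a plain function space). -/
def unitCube (k : ℕ) : Set (Fin k → ℝ) := {y | ∀ i, y i ∈ Set.Icc (0 : ℝ) 1}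

/-- The generalized prism `K̂_φ ⊂ ℝ^{m+1}` determined by a graph function
`φ : [0,1]^m → ℝ`:  `{x : 0 ≤ x_i ≤ 1 (i < d), 0 ≤ x_d ≤ φ(x_1,…,x_{d-1})}`, `d = m+1`. -/
def prism (m : ℕ) (φ : (Fin m → ℝ) → ℝ) : Set (EuclideanSpace ℝ (Fin (m + 1))) :=
  {x | (∀ i : Fin m, x (Fin.castSucc i) ∈ Set.Icc (0 : ℝ) 1) ∧
    x (Fin.last m) ∈ Set.Icc (0 : ℝ) (φ (fun i => x (Fin.castSucc i)))}

/-- The flat base `F̂⁰ = [0,1]^m × {0}` of a generalized prism. -/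
def flatBase (m : ℕ) : Set (EuclideanSpace ℝ (Fin (m + 1))) :=
  {x | (∀ i : Fin m, x (Fin.castSucc i) ∈ Set.Icc (0 : ℝ) 1) ∧ x (Fin.last m) = 0}

/-- The curved base `F̂ = {(x', φ(x')) : x' ∈ [0,1]^m}` of a generalized prism. -/
def curvedBase (m : ℕ) (φ : (Fin m → ℝ) → ℝ) : Set (EuclideanSpace ℝ (Fin (m + 1))) :=
  {x | (∀ i : Fin m, x (Fin.castSucc i) ∈ Set.Icc (0 : ℝ) 1) ∧
    x (Fin.last m) = φ (fun i => x (Fin.castSucc i))}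

/-- `K̂_φ` is a *reference generalized prism*: `φ` is Lipschitz, the unit cube `[0,1]^{m+1}`
is contained in `K̂_φ`, and every segment joining a point of the flat base to a point of the
curved base lies in `K̂_φ` (star-shapedness of `F̂⁰` with respect to `F̂`). -/
def IsRefGenPrism (m : ℕ) (φ : (Fin m → ℝ) → ℝ) : Prop :=
  (∃ L : NNReal, LipschitzWith L φ) ∧
  ({x : EuclideanSpace ℝ (Fin (m + 1)) | ∀ i, x i ∈ Set.Icc (0 : ℝ) 1} ⊆ prism m φ) ∧
  (∀ x ∈ flatBase m, ∀ y ∈ curvedBase m φ, segment ℝ x y ⊆ prism m φ)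

/-- The parameter `r̂ := ⌊max_{[0,1]^m} φ⌋ + 1` of a reference generalized prism. -/
noncomputable def rhat (m : ℕ) (φ : (Fin m → ℝ) → ℝ) : ℕ :=
  Nat.floor (sSup (φ '' unitCube m)) + 1

/-- The constant `C_inv^B(d, r̂) = 64(d-1)r̂(r̂+1)(2r̂+1) + 12d`. -/
def CinvB (d r : ℕ) : ℝ :=
  64 * ((d : ℝ) - 1) * (r : ℝ) * ((r : ℝ) + 1) * (2 * (r : ℝ) + 1) + 12 * (d : ℝ)

/-- The vertically shifted intersection `K̂_ε := K̂ ∩ (K̂ - ε e_d)`, where `e_d` is the `d`-th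
standard basis vector: `x ∈ K̂_ε ↔ x ∈ K̂ ∧ x + ε e_d ∈ K̂`. -/
def prismShift (m : ℕ) (φ : (Fin m → ℝ) → ℝ) (ε : ℝ) : Set (EuclideanSpace ℝ (Fin (m + 1))) :=
  {x | x ∈ prism m φ ∧ x + ε • (EuclideanSpace.single (Fin.last m) (1 : ℝ)) ∈ prism m φ}

namespace Polynomial

/-- Markov's inequality at the right endpoint of `[0, a]`. -/
theorem mul_eval_derivative_le_of_forall_mem_Icc {P : ℝ[X]} {n : ℕ} {a J : ℝ}
    (hP : P.natDegree ≤ n) (ha : 0 ≤ a) (hJ : 0 ≤ J)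
    (h : ∀ t ∈ Set.Icc 0 a, P.eval t ∈ Set.Icc 0 J) :
    a * (derivative P).eval a ≤ n ^ 2 * J := by
  wlog hJ' : 0 < J generalizing J
  · obtain rfl : J = 0 := le_antisymm (not_lt.1 hJ') hJ
    refine le_of_forall_pos_le_add fun δ hδ => ?_
    have hn : (0 : ℝ) < n ^ 2 + 1 := by positivity
    have hδ' : 0 < δ / (n ^ 2 + 1) := by positivity
    refine (this hδ'.le (fun t ht => ⟨(h t ht).1, (h t ht).2.trans hδ'.le⟩) hδ').trans ?_
    rw [mul_zero, zero_add, ← mul_div_assoc, div_le_iff₀ hn]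
    nlinarith
  let R : ℝ[X] := C (2 / J) * P.comp (C (a / 2) * (X + 1)) - 1
  have hdeg : R.degree ≤ n := by
    refine degree_le_of_natDegree_le ((natDegree_sub_le _ _).trans ?_)
    have hlin : (C (a / 2) * (X + 1) : ℝ[X]).natDegree ≤ 1 := by compute_degree
    have := (natDegree_comp_le (p := P) (q := C (a / 2) * (X + 1))).trans
      (Nat.mul_le_mul hP hlin)
    simpa using (natDegree_C_mul_le _ _).trans this
  have hbnd : ∀ x ∈ Set.Icc (-1 : ℝ) 1, |R.eval x| ≤ 1 := by
    intro x hx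
    have ht := h (a / 2 * (x + 1)) ⟨by nlinarith [hx.1], by nlinarith [hx.2]⟩
    have h1 : 2 / J * P.eval (a / 2 * (x + 1)) ≤ 2 := by
      rw [div_mul_eq_mul_div, div_le_iff₀ hJ']
      linarith [ht.2]
    have h0 : 0 ≤ 2 / J * P.eval (a / 2 * (x + 1)) := mul_nonneg (by positivity) ht.1
    simp only [R, eval_sub, eval_mul, eval_C, eval_comp, eval_add, eval_X, eval_one]
    exact abs_le.2 ⟨by linarith, by linarith⟩
  have hM := Chebyshev.eval_iterate_derivative_le_of_forall_abs_le_one (k := 1) le_rfl hdeg hbnd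
  have hT := Chebyshev.iterate_derivative_T_eval_one_recurrence (R := ℝ) n 0
  have hR : (derivative R).eval 1 = a * (derivative P).eval a / J := by
    simp only [R, derivative_sub, derivative_mul, derivative_comp, derivative_C, derivative_add,
      derivative_X, derivative_one, eval_sub, eval_mul, eval_add, eval_C, eval_comp, eval_X,
      eval_one, eval_zero]
    norm_num
    ring
  simp only [Function.iterate_zero, id, Function.iterate_one, zero_add, Nat.cast_zero, mul_zero,
    one_mul, Chebyshev.T_eval_one] at hM hT
  rw [hT, hR, div_le_iff₀ hJ'] at hM
  simpa using hM

/-- Over a field of characteristic zero every polynomial has an antiderivative. -/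
theorem exists_derivative_eq {K : Type*} [Field K] [CharZero K] (P : K[X]) :
    ∃ F : K[X], derivative F = P ∧ F.natDegree ≤ P.natDegree + 1 := by
  refine ⟨∑ i ∈ Finset.range (P.natDegree + 1), monomial (i + 1) (P.coeff i / (i + 1)), ?_, ?_⟩
  · conv_rhs => rw [P.as_sum_range]
    rw [derivative_sum]
    refine Finset.sum_congr rfl fun i _ => ?_
    have : (i : K) + 1 ≠ 0 := Nat.cast_add_one_ne_zero i
    rw [derivative_monomial]
    simp [div_mul_cancel₀ _ this]
  · refine natDegree_sum_le_of_forall_le _ _ fun i hi => (natDegree_monomial_le _).trans ?_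
    have := Finset.mem_range.1 hi
    omega

/-- Pointwise bound of the square of a polynomial at the endpoint of an interval by its
`L²` norm. -/
theorem mul_sq_eval_le_integral {q : ℝ[X]} {p : ℕ} (hq : q.natDegree ≤ p) {a : ℝ} (ha : 0 ≤ a) :
    a * q.eval a ^ 2 ≤ (2 * p + 1) ^ 2 * ∫ t in 0..a, q.eval t ^ 2 := by
  obtain ⟨F, hF, hdeg⟩ := exists_derivative_eq (q ^ 2)
  have hint : ∀ x y : ℝ, ∫ t in x..y, q.eval t ^ 2 = F.eval y - F.eval x := by
    intro x y
    refine intervalIntegral.integral_eq_sub_of_hasDerivAt (f := fun t => F.eval t)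
      (fun t _ => ?_)
      ((by fun_prop : Continuous fun t => q.eval t ^ 2).intervalIntegrable _ _)
    simpa [hF] using F.hasDerivAt t
  have hnn : ∀ x y : ℝ, x ≤ y → 0 ≤ F.eval y - F.eval x := fun x y hxy => by
    rw [← hint]
    exact intervalIntegral.integral_nonneg hxy fun _ _ => sq_nonneg _
  have hdeg' : (F - C (F.eval 0)).natDegree ≤ 2 * p + 1 := by
    rw [natDegree_sub_C]
    refine hdeg.trans (Nat.succ_le_succ (natDegree_pow_le.trans ?_))
    gcongr
  have := mul_eval_derivative_le_of_forall_mem_Icc hdeg' ha (hnn 0 a ha) fun t ht => by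
    have h₁ := hnn 0 t ht.1
    have h₂ := hnn t a ht.2
    simp only [eval_sub, eval_C]
    exact ⟨h₁, by linarith⟩
  rw [hint]
  simpa [hF] using this

/-- The mass of `q²` in the end strip of length `ε` of an interval of length at least one. -/
theorem setIntegral_strip_sq_le {q : ℝ[X]} {p : ℕ} (hq : q.natDegree ≤ p) (hp : 1 ≤ p)
    {h ε : ℝ} (hh : 1 ≤ h) (hε : 0 < ε) :
    ∫ t in Set.Icc 0 h ∩ {t | h < t + ε}, q.eval t ^ 2 ≤
      32 * ε * (p : ℝ) ^ 2 * ∫ t in Set.Icc 0 h, q.eval t ^ 2 := by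
  have hp' : (1 : ℝ) ≤ p := by exact_mod_cast hp
  have hcont : Continuous fun t => q.eval t ^ 2 := q.continuous.pow 2
  have hintg : IntegrableOn (fun t => q.eval t ^ 2) (Set.Icc 0 h) :=
    hcont.continuousOn.integrableOn_compact isCompact_Icc
  set I := ∫ t in Set.Icc 0 h, q.eval t ^ 2
  have hI : 0 ≤ I := setIntegral_nonneg measurableSet_Icc fun _ _ => sq_nonneg _
  rcases le_or_gt 1 (2 * ε) with hε₁ | hε₁
  · calc _ ≤ I := setIntegral_mono_set hintg (ae_of_all _ fun _ => sq_nonneg _)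
          Set.inter_subset_left.eventuallyLE
      _ ≤ _ := le_mul_of_one_le_left hI (by nlinarith)
  have hpt : ∀ t ∈ Set.Icc (h - ε) h, q.eval t ^ 2 ≤ 32 * (p : ℝ) ^ 2 * I := by
    intro t ht
    have ht₂ : 1 / 2 ≤ t := by linarith [ht.1]
    have h₁ := mul_sq_eval_le_integral hq (show 0 ≤ t by linarith)
    have h₂ : ∫ s in 0..t, q.eval s ^ 2 ≤ I := by
      rw [intervalIntegral.integral_of_le (by linarith)]
      exact setIntegral_mono_set hintg (ae_of_all _ fun _ => sq_nonneg _)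
        (Set.Ioc_subset_Icc_self.trans (Set.Icc_subset_Icc_right ht.2)).eventuallyLE
    have h₃ : (2 * (p : ℝ) + 1) ^ 2 * ∫ s in 0..t, q.eval s ^ 2 ≤ 9 * (p : ℝ) ^ 2 * I :=
      mul_le_mul (by nlinarith) h₂
        (intervalIntegral.integral_nonneg (by linarith) fun _ _ => sq_nonneg _) (by positivity)
    have h₄ : 0 ≤ (p : ℝ) ^ 2 * I := by positivity
    nlinarith [sq_nonneg (q.eval t)]
  calc _ ≤ ∫ t in Set.Icc (h - ε) h, q.eval t ^ 2 :=
        setIntegral_mono_set (hcont.continuousOn.integrableOn_compact isCompact_Icc)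
          (ae_of_all _ fun _ => sq_nonneg _) (LE.le.eventuallyLE fun t ht =>
            ⟨by have := ht.2; simp only [Set.mem_ofPred_eq] at this; linarith, ht.1.2⟩)
    _ ≤ ∫ _ in Set.Icc (h - ε) h, 32 * (p : ℝ) ^ 2 * I :=
        setIntegral_mono_on (hcont.continuousOn.integrableOn_compact isCompact_Icc)
          (continuousOn_const.integrableOn_compact isCompact_Icc) measurableSet_Icc hpt
    _ = _ := by
        rw [setIntegral_const, Real.volume_real_Icc_of_le (by linarith), smul_eq_mul]
        ring

end Polynomial

namespace MvPolynomial

/-- The restriction of a polynomial in `m + 1` variables to a line parallel to the last axis. -/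
theorem exists_natDegree_le_eval_snoc {R : Type*} [CommRing R] {m p : ℕ}
    (v : MvPolynomial (Fin (m + 1)) R) (hv : v.totalDegree ≤ p) (y : Fin m → R) :
    ∃ q : Polynomial R, q.natDegree ≤ p ∧
      ∀ t, q.eval t = eval (Fin.insertNth (α := fun _ => R) (Fin.last m) t y) v := by
  refine ⟨aeval (Fin.insertNth (α := fun _ => Polynomial R) (Fin.last m) Polynomial.X
    fun i => Polynomial.C (y i)) v, ?_, fun t => ?_⟩
  · rw [← mul_one p]
    refine aeval_natDegree_le v hv _ fun i => ?_
    refine Fin.lastCases ?_ (fun j => ?_) i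
    · simpa using Polynomial.natDegree_X_le
    · simp
  · rw [← Polynomial.coe_evalRingHom, aeval_def, hom_eval₂]
    have : (Polynomial.evalRingHom t).comp (algebraMap R (Polynomial R)) = RingHom.id R := by
      ext; simp
    rw [this, ← eval₂_id]
    congr 1
    ext i
    refine Fin.lastCases ?_ (fun j => ?_) i <;> simp

end MvPolynomial

/-- Monotonicity of set integrals on a product, checked on the fibers over the second factor. -/
theorem setIntegral_prod_le_of_fiber_le {α β : Type*} [MeasurableSpace α] [MeasurableSpace β]
    {μ : Measure α} {ν : Measure β} [SFinite μ] [SFinite ν] {G : α × β → ℝ} {S A : Set (α × β)}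
    (hS : MeasurableSet S) (hA : MeasurableSet A) (hSA : S ⊆ A)
    (hG : IntegrableOn G A (μ.prod ν)) {c : ℝ}
    (h : ∀ y, ∫ t in (fun t => (t, y)) ⁻¹' S, G (t, y) ∂μ ≤
      c * ∫ t in (fun t => (t, y)) ⁻¹' A, G (t, y) ∂μ) :
    ∫ z in S, G z ∂μ.prod ν ≤ c * ∫ z in A, G z ∂μ.prod ν := by
  have hfib : ∀ B : Set (α × β), MeasurableSet B → ∀ y,
      ∫ t, B.indicator G (t, y) ∂μ = ∫ t in (fun t => (t, y)) ⁻¹' B, G (t, y) ∂μ := by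
    intro B hB y
    rw [← integral_indicator (measurable_prodMk_right hB)]
    rfl
  have hGS := (integrable_indicator_iff hS).2 (hG.mono_set hSA)
  have hGA := (integrable_indicator_iff hA).2 hG
  rw [← integral_indicator hS, ← integral_indicator hA, integral_prod_symm _ hGS,
    integral_prod_symm _ hGA, ← integral_const_mul]
  refine integral_mono hGS.integral_prod_right (hGA.integral_prod_right.const_mul c) fun y => ?_
  simpa only [hfib S hS, hfib A hA] using h y

/-- The coordinates `(x_d, x')` on `ℝ^d`, with the last coordinate split off. -/
noncomputable def splitLast (m : ℕ) : EuclideanSpace ℝ (Fin (m + 1)) ≃ᵐ ℝ × (Fin m → ℝ) :=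
  (MeasurableEquiv.toLp 2 (Fin (m + 1) → ℝ)).symm.trans
    (MeasurableEquiv.piFinSuccAbove (fun _ => ℝ) (Fin.last m))

theorem splitLast_apply (m : ℕ) (x : EuclideanSpace ℝ (Fin (m + 1))) :
    splitLast m x = (x (Fin.last m), fun i => x (Fin.castSucc i)) := by
  ext i
  · rfl
  · simp [splitLast, MeasurableEquiv.piFinSuccAbove, Fin.init]

theorem measurePreserving_splitLast (m : ℕ) : MeasurePreserving (splitLast m) :=
  (EuclideanSpace.volume_preserving_symm_measurableEquiv_toLp _).trans
    (volume_preserving_piFinSuccAbove (fun _ => ℝ) (Fin.last m))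

/-- The prism in the coordinates `(x_d, x')`. -/
def prismCoord (m : ℕ) (φ : (Fin m → ℝ) → ℝ) : Set (ℝ × (Fin m → ℝ)) :=
  {z | z.2 ∈ unitCube m ∧ z.1 ∈ Set.Icc 0 (φ z.2)}

theorem isCompact_unitCube (k : ℕ) : IsCompact (unitCube k) := by
  have : unitCube k = Set.univ.pi fun _ => Set.Icc (0 : ℝ) 1 := by
    ext; simp only [unitCube, Set.mem_univ_pi, Set.mem_ofPred_eq]
  rw [this]
  exact isCompact_univ_pi fun _ => isCompact_Icc

theorem isCompact_prismCoord {m : ℕ} {φ : (Fin m → ℝ) → ℝ} (hφ : Continuous φ) :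
    IsCompact (prismCoord m φ) := by
  obtain ⟨M, hM⟩ := (isCompact_unitCube m).bddAbove_image hφ.continuousOn
  refine ((isCompact_Icc (a := (0 : ℝ)) (b := M)).prod (isCompact_unitCube m)).of_isClosed_subset
    ?_ fun z hz => ⟨⟨hz.2.1, hz.2.2.trans (hM ⟨_, hz.1, rfl⟩)⟩, hz.1⟩
  exact ((isCompact_unitCube m).isClosed.preimage continuous_snd).inter
    ((isClosed_le continuous_const continuous_fst).inter
      (isClosed_le continuous_fst (hφ.comp continuous_snd)))

theorem prism_eq_preimage (m : ℕ) (φ : (Fin m → ℝ) → ℝ) :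
    prism m φ = splitLast m ⁻¹' prismCoord m φ := by
  ext x
  simp [prism, prismCoord, unitCube, splitLast_apply]

theorem prism_diff_prismShift_eq_preimage (m : ℕ) (φ : (Fin m → ℝ) → ℝ) {ε : ℝ} (hε : 0 < ε) :
    prism m φ \ prismShift m φ ε =
      splitLast m ⁻¹' (prismCoord m φ ∩ {z | φ z.2 < z.1 + ε}) := by
  rw [Set.preimage_inter, ← prism_eq_preimage]
  ext x
  simp only [Set.mem_sdiff, Set.mem_inter_iff, and_congr_right_iff]
  intro hx
  have hx' : 0 ≤ x (Fin.last m) + ε := by linarith [hx.2.1]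
  simp only [prismShift, Set.mem_ofPred_eq, hx, true_and, Set.mem_preimage, splitLast_apply]
  simp only [prism, Set.mem_ofPred_eq, PiLp.add_apply, PiLp.smul_apply, PiLp.single_apply,
    (Fin.castSucc_lt_last _).ne, if_false, if_true, smul_eq_mul, mul_zero, mul_one, add_zero,
    Set.mem_Icc, hx', true_and, not_and, not_le]
  exact ⟨fun h => h hx.1, fun h _ => h⟩

theorem IsRefGenPrism.one_le {m : ℕ} {φ : (Fin m → ℝ) → ℝ} (hφ : IsRefGenPrism m φ)
    {y : Fin m → ℝ} (hy : y ∈ unitCube m) : 1 ≤ φ y := by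
  have hmem : WithLp.toLp 2 (Fin.snoc (α := fun _ => ℝ) y 1) ∈ prism m φ := hφ.2.1 fun i => by
    refine Fin.lastCases ?_ (fun j => ?_) i
    · simp
    · simpa using hy j
  simpa using hmem.2.2

/-- **Strip estimate for polynomials on a generalized prism** (estimate `strip_small_gen`
in the proof of Lemma `new_chop`).
For a reference generalized prism `K̂`, `K̂_ε := K̂ ∩ (K̂ - ε e_d)`, every `p ≥ 1`, every real
polynomial `v` of total degree at most `p`, and every `ε > 0`,
`∫_{K̂ ∖ K̂_ε} v² ≤ 32 ε p² ∫_{K̂} v²`. -/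
theorem polynomial_strip_estimate_prism
    (m p : ℕ) (hm : 1 ≤ m) (hp : 1 ≤ p)
    (φ : (Fin m → ℝ) → ℝ) (hφ : IsRefGenPrism m φ)
    (v : MvPolynomial (Fin (m + 1)) ℝ) (hv : v.totalDegree ≤ p)
    (ε : ℝ) (hε : 0 < ε) :
    ∫ x in prism m φ \ prismShift m φ ε, (MvPolynomial.eval (fun j => x j) v) ^ 2 ≤
      32 * ε * (p : ℝ) ^ 2 * ∫ x in prism m φ, (MvPolynomial.eval (fun j => x j) v) ^ 2 := by
  obtain ⟨L, hL⟩ := hφ.1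
  have hcont : Continuous φ := hL.continuous
  set G : ℝ × (Fin m → ℝ) → ℝ := fun z =>
    (MvPolynomial.eval (Fin.insertNth (α := fun _ => ℝ) (Fin.last m) z.1 z.2) v) ^ 2 with hG
  have hGcont : Continuous G := by
    refine (v.continuous_eval.comp ?_).pow 2
    exact Continuous.finInsertNth _ continuous_fst continuous_snd
  have hGe : ∀ x : EuclideanSpace ℝ (Fin (m + 1)),
      (MvPolynomial.eval (fun j => x j) v) ^ 2 = G (splitLast m x) := by
    intro x
    simp only [hG, splitLast_apply]
    congr 3
    ext i
    refine Fin.lastCases ?_ (fun j => ?_) i <;> simp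
  have hA := (isCompact_prismCoord hcont).measurableSet
  have hS : MeasurableSet (prismCoord m φ ∩ {z | φ z.2 < z.1 + ε}) :=
    hA.inter (measurableSet_lt (by fun_prop) (by fun_prop))
  simp_rw [hGe]
  rw [prism_diff_prismShift_eq_preimage m φ hε, prism_eq_preimage,
    (measurePreserving_splitLast m).setIntegral_preimage_emb (splitLast m).measurableEmbedding,
    (measurePreserving_splitLast m).setIntegral_preimage_emb (splitLast m).measurableEmbedding]
  refine setIntegral_prod_le_of_fiber_le hS hA Set.inter_subset_left
    (hGcont.continuousOn.integrableOn_compact (isCompact_prismCoord hcont)) fun y => ?_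
  by_cases hy : y ∈ unitCube m
  · obtain ⟨q, hq, hqe⟩ := v.exists_natDegree_le_eval_snoc hv y
    have := Polynomial.setIntegral_strip_sq_le hq hp (hφ.one_le hy) hε
    simpa [hG, hqe, prismCoord, hy, Set.preimage, Set.inter_def, Set.Icc] using this
  · simp [prismCoord, hy]
end

section
/- Let φ, ψ : [0,1]^{d−1} → ℝ be Lipschitz functions such that both subgraph sets K̂_φ := {x : 0 ≤ x_i ≤ 1 for i < d, 0 ≤ x_d ≤ φ(x_1,…,x_{d−1})} and K̂_ψ (defined analogously) contain the unit cube [0,1]^d. If ‖φ − ψ‖_{L∞([0,1]^{d−1})} ≤ (8p)^{−2} for some p ≥ 1, then for every real polynomial v of total degree at most p in d variables, (1/2) ∫_{K̂_φ} v² dx ≤ ∫_{K̂_ψ} v² dx ≤ 2 ∫_{K̂_φ} v² dx. -/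
open MeasureTheory

open Polynomial in
/-- Integration by parts on `[0,1]` for polynomials. -/
theorem integral_eval_mul_derivative (r f : ℝ[X]) :
    ∫ x in (0 : ℝ)..1, r.eval x * (derivative f).eval x =
      r.eval 1 * f.eval 1 - r.eval 0 * f.eval 0 -
        ∫ x in (0 : ℝ)..1, (derivative r).eval x * f.eval x :=
  intervalIntegral.integral_mul_deriv_eq_deriv_mul
    (fun x _ => r.hasDerivAt x) (fun x _ => f.hasDerivAt x)
    ((derivative r).continuous.intervalIntegrable _ _)
    ((derivative f).continuous.intervalIntegrable _ _)

open Polynomial in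
theorem eval_iterate_derivative_eq_zero_of_pow_dvd {f : ℝ[X]} {a : ℝ} {n k : ℕ}
    (h : (X - C a) ^ n ∣ f) (hk : k < n) : (derivative^[k] f).eval a = 0 := by
  have h1 := pow_sub_dvd_iterate_derivative_of_pow_dvd k h
  have h2 : (X - C a) ∣ derivative^[k] f :=
    (dvd_pow_self _ (Nat.sub_ne_zero_of_lt hk)).trans h1
  exact dvd_iff_isRoot.1 h2

open Polynomial in
/-- The `n`-th derivative of a polynomial vanishing to order `n` at both endpoints of `[0,1]` is
orthogonal to all polynomials of degree less than `n`. -/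
theorem integral_eval_mul_iterate_derivative_eq_zero (n : ℕ) :
    ∀ r f : ℝ[X], derivative^[n] r = 0 → (X - C 0) ^ n ∣ f → (X - C 1) ^ n ∣ f →
      ∫ x in (0 : ℝ)..1, r.eval x * (derivative^[n] f).eval x = 0 := by
  induction n with
  | zero =>
    intro r f hr _ _
    simp only [Function.iterate_zero, id] at hr
    simp [hr]
  | succ n ih =>
    intro r f hr h0 h1
    rw [Function.iterate_succ_apply', integral_eval_mul_derivative,
      eval_iterate_derivative_eq_zero_of_pow_dvd h0 n.lt_succ_self,
      eval_iterate_derivative_eq_zero_of_pow_dvd h1 n.lt_succ_self,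
      ih (derivative r) f (by simpa using hr) ((pow_dvd_pow _ n.le_succ).trans h0)
        ((pow_dvd_pow _ n.le_succ).trans h1)]
    simp

open Polynomial in
theorem eval_one_iterate_derivative_eq_factorial_mul_coeff (f : ℝ[X]) (k : ℕ) :
    (derivative^[k] f).eval 1 = k.factorial * (taylor 1 f).coeff k := by
  rw [taylor_coeff, ← factorial_smul_hasseDeriv]
  simp

open Polynomial in
theorem taylor_one_X_pow_mul (p : ℕ) :
    taylor 1 ((X : ℝ[X]) ^ (p + 1) * (X - C 1) ^ p) = (X + 1) ^ (p + 1) * X ^ p := by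
  simp [taylor_mul, taylor_pow]

open Polynomial in
/-- There is a reproducing polynomial on `[0,1]` for the value at `1`. -/
theorem exists_reproducing_polynomial (p : ℕ) :
    ∃ K : ℝ[X], K.natDegree ≤ p ∧ K.eval 1 = ((p : ℝ) + 1) ^ 2 ∧
      ∀ q : ℝ[X], q.natDegree ≤ p → ∫ x in (0 : ℝ)..1, q.eval x * K.eval x = q.eval 1 := by
  have hp : (p.factorial : ℝ) ≠ 0 := by positivity
  set f : ℝ[X] := X ^ (p + 1) * (X - C 1) ^ p with hf
  have h0 : (X - C 0) ^ (p + 1) ∣ f := by rw [C_0, sub_zero]; exact dvd_mul_right _ _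
  have h1 : (X - C 1) ^ p ∣ f := dvd_mul_left _ _
  have hdeg : f.natDegree ≤ 2 * p + 1 := by
    refine natDegree_mul_le.trans ?_
    rw [natDegree_X_pow, natDegree_pow, natDegree_X_sub_C]
    lia
  have e1 : (derivative^[p] f).eval 1 = p.factorial := by
    rw [eval_one_iterate_derivative_eq_factorial_mul_coeff, taylor_one_X_pow_mul]
    have h := coeff_mul_X_pow ((X + 1 : ℝ[X]) ^ (p + 1)) p 0
    rw [zero_add] at h
    simp [h, coeff_zero_eq_eval_zero]
  have e2 : (derivative^[p + 1] f).eval 1 = p.factorial * ((p : ℝ) + 1) ^ 2 := by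
    rw [eval_one_iterate_derivative_eq_factorial_mul_coeff, taylor_one_X_pow_mul,
      add_comm p 1, coeff_mul_X_pow, coeff_X_add_one_pow, add_comm 1 p, Nat.factorial_succ]
    push_cast [Nat.choose_one_right]
    ring
  refine ⟨C (p.factorial : ℝ)⁻¹ * derivative^[p + 1] f, ?_, ?_, ?_⟩
  · refine (natDegree_C_mul_le _ _).trans ((natDegree_iterate_derivative _ _).trans ?_)
    lia
  · rw [eval_mul, eval_C, e2]
    field_simp
  · intro q hq
    have key : ∫ x in (0 : ℝ)..1, q.eval x * (derivative^[p + 1] f).eval x =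
        q.eval 1 * p.factorial := by
      rw [Function.iterate_succ_apply', integral_eval_mul_derivative, e1,
        eval_iterate_derivative_eq_zero_of_pow_dvd h0 p.lt_succ_self,
        integral_eval_mul_iterate_derivative_eq_zero p (derivative q) f
          (by
            rw [← Function.iterate_succ_apply]
            exact iterate_derivative_eq_zero (Nat.lt_succ_of_le hq))
          ((pow_dvd_pow _ p.le_succ).trans h0) h1]
      simp
    have : ∀ x, q.eval x * (C (p.factorial : ℝ)⁻¹ * derivative^[p + 1] f).eval x =
        (p.factorial : ℝ)⁻¹ * (q.eval x * (derivative^[p + 1] f).eval x) := by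
      intro x
      rw [eval_mul, eval_C]
      ring
    simp_rw [this]
    rw [intervalIntegral.integral_const_mul, key]
    field_simp

open Polynomial in
theorem sq_eval_one_le_integral (p : ℕ) (q : ℝ[X]) (hq : q.natDegree ≤ p) :
    q.eval 1 ^ 2 ≤ ((p : ℝ) + 1) ^ 2 * ∫ x in (0 : ℝ)..1, q.eval x ^ 2 := by
  obtain ⟨K, hK, hK1, hrep⟩ := exists_reproducing_polynomial p
  set c : ℝ := ((p : ℝ) + 1) ^ 2 with hc
  have hcpos : 0 < c := by positivity
  have hKK := hrep K hK
  have hqK := hrep q hq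
  have hnn : 0 ≤ ∫ x in (0 : ℝ)..1, (c * q.eval x - q.eval 1 * K.eval x) ^ 2 :=
    intervalIntegral.integral_nonneg zero_le_one fun _ _ => sq_nonneg _
  have hexp : ∫ x in (0 : ℝ)..1, (c * q.eval x - q.eval 1 * K.eval x) ^ 2 =
      c ^ 2 * (∫ x in (0 : ℝ)..1, q.eval x ^ 2) - 2 * c * q.eval 1 * q.eval 1 +
        q.eval 1 ^ 2 * c := by
    have : ∀ x, (c * q.eval x - q.eval 1 * K.eval x) ^ 2 =
        c ^ 2 * q.eval x ^ 2 - 2 * c * q.eval 1 * (q.eval x * K.eval x) +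
          q.eval 1 ^ 2 * (K.eval x * K.eval x) := fun x => by ring
    simp_rw [this]
    have i1 : IntervalIntegrable (fun x => c ^ 2 * q.eval x ^ 2) volume 0 1 :=
      Continuous.intervalIntegrable (by fun_prop) _ _
    have i2 : IntervalIntegrable (fun x => 2 * c * q.eval 1 * (q.eval x * K.eval x)) volume 0 1 :=
      Continuous.intervalIntegrable (by fun_prop) _ _
    have i3 : IntervalIntegrable (fun x => q.eval 1 ^ 2 * (K.eval x * K.eval x)) volume 0 1 :=
      Continuous.intervalIntegrable (by fun_prop) _ _
    rw [intervalIntegral.integral_add (i1.sub i2) i3, intervalIntegral.integral_sub i1 i2,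
      intervalIntegral.integral_const_mul, intervalIntegral.integral_const_mul,
      intervalIntegral.integral_const_mul, hKK, hqK, hK1]
  rw [hexp] at hnn
  have : 0 ≤ c * (c * (∫ x in (0 : ℝ)..1, q.eval x ^ 2) - q.eval 1 ^ 2) := by linarith
  linarith [nonneg_of_mul_nonneg_right this hcpos]

open Polynomial in
/-- Endpoint Nikolskii inequality on `[0,x]`. -/
theorem mul_sq_eval_le_integral (p : ℕ) (q : ℝ[X]) (hq : q.natDegree ≤ p) {x : ℝ} (hx : 0 < x) :
    x * q.eval x ^ 2 ≤ ((p : ℝ) + 1) ^ 2 * ∫ t in (0 : ℝ)..x, q.eval t ^ 2 := by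
  have hdeg : (q.comp (C x * X)).natDegree ≤ p := by
    refine natDegree_comp_le.trans ?_
    calc q.natDegree * (C x * X).natDegree ≤ q.natDegree * 1 :=
          Nat.mul_le_mul_left _ ((natDegree_C_mul_le x X).trans natDegree_X_le)
      _ ≤ p := by lia
  have h := sq_eval_one_le_integral p _ hdeg
  simp only [eval_comp, eval_mul, eval_C, eval_X, mul_one] at h
  rw [intervalIntegral.integral_comp_mul_left (fun t => q.eval t ^ 2) hx.ne', mul_zero, mul_one,
    smul_eq_mul] at h
  have h2 := mul_le_mul_of_nonneg_left h hx.le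
  refine h2.trans_eq ?_
  field_simp

open Polynomial in
theorem integral_sq_le_two_mul_integral_sq {p : ℕ} (hp : 1 ≤ p) (q : ℝ[X])
    (hq : q.natDegree ≤ p) {a b : ℝ} (ha : 1 ≤ a)
    (hab : |a - b| ≤ ((8 * (p : ℝ)) ^ 2)⁻¹) :
    ∫ t in (0 : ℝ)..b, q.eval t ^ 2 ≤ 2 * ∫ t in (0 : ℝ)..a, q.eval t ^ 2 := by
  have hint : ∀ c d : ℝ, IntervalIntegrable (fun t => q.eval t ^ 2) volume c d := fun c d =>
    Continuous.intervalIntegrable (by fun_prop) _ _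
  have hnn : ∀ c d : ℝ, c ≤ d → 0 ≤ ∫ t in c..d, q.eval t ^ 2 := fun c d h =>
    intervalIntegral.integral_nonneg h fun _ _ => sq_nonneg _
  have hadd := intervalIntegral.integral_add_adjacent_intervals (hint 0 a) (hint a b)
  have hA := hnn 0 a (by linarith)
  rcases le_total b a with h | h
  · have := hnn b a h
    rw [intervalIntegral.integral_symm] at this
    linarith
  · set I := ∫ t in (0 : ℝ)..b, q.eval t ^ 2 with hI
    have hI0 : 0 ≤ I := hnn 0 b (by linarith)
    have hpt : ∀ x ∈ Set.Icc a b, q.eval x ^ 2 ≤ ((p : ℝ) + 1) ^ 2 * I := by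
      intro x hx
      have hx1 : 1 ≤ x := ha.trans hx.1
      have h1 := mul_sq_eval_le_integral p q hq (x := x) (by linarith)
      have h2 : ∫ t in (0 : ℝ)..x, q.eval t ^ 2 ≤ I := by
        have := intervalIntegral.integral_add_adjacent_intervals (hint 0 x) (hint x b)
        linarith [hnn x b hx.2]
      calc q.eval x ^ 2 ≤ x * q.eval x ^ 2 := le_mul_of_one_le_left (sq_nonneg _) hx1
        _ ≤ _ := h1
        _ ≤ _ := by gcongr
    have h1 : ∫ t in a..b, q.eval t ^ 2 ≤ ∫ _ in a..b, ((p : ℝ) + 1) ^ 2 * I :=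
      intervalIntegral.integral_mono_on h (hint a b) intervalIntegrable_const hpt
    rw [intervalIntegral.integral_const, smul_eq_mul] at h1
    have hp' : (1 : ℝ) ≤ p := by exact_mod_cast hp
    have hba : b - a ≤ ((8 * (p : ℝ)) ^ 2)⁻¹ := by
      rw [abs_sub_comm] at hab
      exact (le_abs_self _).trans hab
    have h2 : (b - a) * ((p : ℝ) + 1) ^ 2 ≤ 1 / 2 := by
      calc (b - a) * ((p : ℝ) + 1) ^ 2 ≤ ((8 * (p : ℝ)) ^ 2)⁻¹ * ((p : ℝ) + 1) ^ 2 := by gcongr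
        _ ≤ 1 / 2 := by
          rw [inv_mul_le_iff₀ (by positivity)]
          nlinarith
    have h3 := mul_le_mul_of_nonneg_right h2 hI0
    linarith

/-- The fiber coordinates `x ↦ (x_d, (x_1, …, x_{d-1}))`. -/
def fiberCoord (m : ℕ) : EuclideanSpace ℝ (Fin (m + 1)) ≃ᵐ ℝ × (Fin m → ℝ) :=
  (MeasurableEquiv.toLp 2 (Fin (m + 1) → ℝ)).symm.trans
    (MeasurableEquiv.piFinSuccAbove (fun _ => ℝ) (Fin.last m))

theorem fiberCoord_apply (m : ℕ) (x : EuclideanSpace ℝ (Fin (m + 1))) :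
    fiberCoord m x = (x (Fin.last m), fun i => x (Fin.castSucc i)) := by
  refine Prod.ext rfl (funext fun i => ?_)
  change x ((Fin.last m).succAbove i) = _
  rw [Fin.succAbove_last]

theorem measurePreserving_fiberCoord (m : ℕ) :
    MeasurePreserving (fiberCoord m) volume volume :=
  (volume_preserving_piFinSuccAbove (fun _ : Fin (m + 1) => ℝ) (Fin.last m)).comp
    (EuclideanSpace.volume_preserving_symm_measurableEquiv_toLp _)

/-- The prism in fiber coordinates. -/
def fiberPrism (m : ℕ) (φ : (Fin m → ℝ) → ℝ) : Set (ℝ × (Fin m → ℝ)) :=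
  {z | z.2 ∈ unitCube m ∧ z.1 ∈ Set.Icc (0 : ℝ) (φ z.2)}

theorem setIntegral_prism (m : ℕ) (φ : (Fin m → ℝ) → ℝ) (v : MvPolynomial (Fin (m + 1)) ℝ) :
    ∫ x in prism m φ, (MvPolynomial.eval (fun j => x j) v) ^ 2 =
      ∫ z in fiberPrism m φ, (MvPolynomial.eval (Fin.snoc z.2 z.1 : Fin (m + 1) → ℝ) v) ^ 2 := by
  rw [← (measurePreserving_fiberCoord m).setIntegral_preimage_emb
    (fiberCoord m).measurableEmbedding]
  have hset : fiberCoord m ⁻¹' fiberPrism m φ = prism m φ := by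
    ext x
    simp only [Set.mem_preimage, fiberCoord_apply]
    rfl
  rw [hset]
  congr 1
  funext x
  rw [fiberCoord_apply]
  congr 3
  funext j
  refine Fin.lastCases ?_ (fun i => ?_) j
  · simp
  · simp

theorem unitCube_eq_Icc (m : ℕ) : unitCube m = Set.Icc 0 1 := by
  ext y
  simp [unitCube, Set.mem_Icc, Pi.le_def, forall_and]

theorem isCompact_fiberPrism (m : ℕ) {φ : (Fin m → ℝ) → ℝ} (hφ : Continuous φ) :
    IsCompact (fiberPrism m φ) := by
  have hc : IsCompact (unitCube m) := by
    rw [unitCube_eq_Icc]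
    exact isCompact_Icc
  obtain ⟨B, hB⟩ := hc.bddAbove_image hφ.continuousOn
  refine ((isCompact_Icc (a := (0 : ℝ)) (b := B)).prod hc).of_isClosed_subset ?_ ?_
  · refine (hc.isClosed.preimage continuous_snd).inter ?_
    exact (isClosed_le continuous_const continuous_fst).inter
      (isClosed_le continuous_fst (hφ.comp continuous_snd))
  · rintro z ⟨h1, h2, h3⟩
    exact ⟨⟨h2, h3.trans (hB ⟨_, h1, rfl⟩)⟩, h1⟩

theorem integral_indicator_fiberPrism (m : ℕ) (φ : (Fin m → ℝ) → ℝ)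
    (G : ℝ × (Fin m → ℝ) → ℝ) {y : Fin m → ℝ} (hy : y ∈ unitCube m) (h : 0 ≤ φ y) :
    ∫ t, (fiberPrism m φ).indicator G (t, y) = ∫ t in (0 : ℝ)..φ y, G (t, y) := by
  rw [intervalIntegral.integral_of_le h, ← integral_Icc_eq_integral_Ioc,
    ← integral_indicator measurableSet_Icc]
  congr 1
  funext t
  simp [Set.indicator, fiberPrism, hy]

theorem setIntegral_fiberPrism_le {m : ℕ} {φ ψ : (Fin m → ℝ) → ℝ} (hφ : Continuous φ)
    (hψ : Continuous ψ) (hφ0 : ∀ y ∈ unitCube m, 0 ≤ φ y) (hψ0 : ∀ y ∈ unitCube m, 0 ≤ ψ y)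
    {G : ℝ × (Fin m → ℝ) → ℝ} (hG : Continuous G) {c : ℝ}
    (h : ∀ y ∈ unitCube m,
      ∫ t in (0 : ℝ)..ψ y, G (t, y) ≤ c * ∫ t in (0 : ℝ)..φ y, G (t, y)) :
    ∫ z in fiberPrism m ψ, G z ≤ c * ∫ z in fiberPrism m φ, G z := by
  have cφ := isCompact_fiberPrism m hφ
  have cψ := isCompact_fiberPrism m hψ
  have iφ : Integrable ((fiberPrism m φ).indicator G) (volume.prod volume) :=
    (hG.continuousOn.integrableOn_compact cφ).integrable_indicator cφ.isClosed.measurableSet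
  have iψ : Integrable ((fiberPrism m ψ).indicator G) (volume.prod volume) :=
    (hG.continuousOn.integrableOn_compact cψ).integrable_indicator cψ.isClosed.measurableSet
  rw [← integral_indicator cφ.isClosed.measurableSet,
    ← integral_indicator cψ.isClosed.measurableSet, Measure.volume_eq_prod,
    integral_prod_symm _ iφ, integral_prod_symm _ iψ, ← integral_const_mul]
  refine integral_mono iψ.integral_prod_right (iφ.integral_prod_right.const_mul c) fun y => ?_
  by_cases hy : y ∈ unitCube m
  · simp only [integral_indicator_fiberPrism m _ G hy (hφ0 y hy),
      integral_indicator_fiberPrism m _ G hy (hψ0 y hy)]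
    exact h y hy
  · simp [Set.indicator, fiberPrism, hy]

theorem one_le_of_unitCube_subset_prism {m : ℕ} {φ : (Fin m → ℝ) → ℝ}
    (h : {x : EuclideanSpace ℝ (Fin (m + 1)) | ∀ i, x i ∈ Set.Icc (0 : ℝ) 1} ⊆ prism m φ)
    {y : Fin m → ℝ} (hy : y ∈ unitCube m) : 1 ≤ φ y := by
  have hx : WithLp.toLp 2 (Fin.snoc y 1 : Fin (m + 1) → ℝ) ∈ prism m φ := by
    refine h fun i => ?_
    refine Fin.lastCases ?_ (fun j => ?_) i
    · simp
    · simpa using hy j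
  simpa using hx.2.2

open Polynomial in
theorem exists_fiber_polynomial {m p : ℕ} (v : MvPolynomial (Fin (m + 1)) ℝ)
    (hv : v.totalDegree ≤ p) (y : Fin m → ℝ) :
    ∃ q : ℝ[X], q.natDegree ≤ p ∧
      ∀ t, q.eval t = MvPolynomial.eval (Fin.snoc y t : Fin (m + 1) → ℝ) v := by
  let f : Fin (m + 1) → ℝ[X] := Fin.snoc (fun i => C (y i)) X
  refine ⟨MvPolynomial.aeval f v, ?_, fun t => ?_⟩
  · have := MvPolynomial.aeval_natDegree_le (n := 1) v hv f fun i => by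
      refine Fin.lastCases ?_ (fun j => ?_) i
      · simp [f]
      · simp [f]
    simpa using this
  · rw [← coe_evalRingHom, MvPolynomial.map_aeval, MvPolynomial.eval, MvPolynomial.coe_eval₂Hom,
      MvPolynomial.coe_eval₂Hom]
    congr 1
    · ext
      simp
    · funext i
      refine Fin.lastCases ?_ (fun j => ?_) i
      · simp [f]
      · simp [f]

theorem setIntegral_prism_le_two_mul {m p : ℕ} (hp : 1 ≤ p) {φ ψ : (Fin m → ℝ) → ℝ}
    (hφ : Continuous φ) (hψ : Continuous ψ)
    (hφ1 : ∀ y ∈ unitCube m, 1 ≤ φ y) (hψ1 : ∀ y ∈ unitCube m, 1 ≤ ψ y)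
    (hclose : ∀ y ∈ unitCube m, |φ y - ψ y| ≤ ((8 * (p : ℝ)) ^ 2)⁻¹)
    (v : MvPolynomial (Fin (m + 1)) ℝ) (hv : v.totalDegree ≤ p) :
    ∫ x in prism m ψ, (MvPolynomial.eval (fun j => x j) v) ^ 2 ≤
      2 * ∫ x in prism m φ, (MvPolynomial.eval (fun j => x j) v) ^ 2 := by
  rw [setIntegral_prism, setIntegral_prism]
  refine setIntegral_fiberPrism_le hφ hψ (fun y hy => zero_le_one.trans (hφ1 y hy))
    (fun y hy => zero_le_one.trans (hψ1 y hy)) ?_ fun y hy => ?_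
  · refine Continuous.pow (v.continuous_eval.comp (continuous_pi fun i => ?_)) 2
    refine Fin.lastCases ?_ (fun j => ?_) i
    · simpa using continuous_fst
    · simpa using (by fun_prop : Continuous fun a : ℝ × (Fin m → ℝ) => a.2 j)
  · obtain ⟨q, hq, hqe⟩ := exists_fiber_polynomial v hv y
    simp only [← hqe]
    exact integral_sq_le_two_mul_integral_sq hp q hq (hφ1 y hy) (hclose y hy)

/-- **Comparison of polynomial `L₂`-norms over `ε`-close generalized prisms**
(the two-sided estimate in the proof of Lemma `basic_Linfty_L2`).
If `φ, ψ : [0,1]^{d-1} → ℝ` are Lipschitz, both subgraph sets `K̂_φ`, `K̂_ψ` contain the unit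
cube `[0,1]^d`, and `‖φ - ψ‖_{L∞([0,1]^{d-1})} ≤ (8p)⁻²` for some `p ≥ 1`, then every real
polynomial `v` of total degree at most `p` satisfies
`(1/2) ∫_{K̂_φ} v² ≤ ∫_{K̂_ψ} v² ≤ 2 ∫_{K̂_φ} v²`. -/
theorem polynomial_L2_close_prisms
    (m p : ℕ) (hm : 1 ≤ m) (hp : 1 ≤ p)
    (φ ψ : (Fin m → ℝ) → ℝ)
    (hφLip : ∃ L : NNReal, LipschitzWith L φ)
    (hψLip : ∃ L : NNReal, LipschitzWith L ψ)
    (hφcube : {x : EuclideanSpace ℝ (Fin (m + 1)) | ∀ i, x i ∈ Set.Icc (0 : ℝ) 1} ⊆ prism m φ)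
    (hψcube : {x : EuclideanSpace ℝ (Fin (m + 1)) | ∀ i, x i ∈ Set.Icc (0 : ℝ) 1} ⊆ prism m ψ)
    (hclose : ∀ y ∈ unitCube m, |φ y - ψ y| ≤ ((8 * (p : ℝ)) ^ 2)⁻¹)
    (v : MvPolynomial (Fin (m + 1)) ℝ) (hv : v.totalDegree ≤ p) :
    (1 / 2) * ∫ x in prism m φ, (MvPolynomial.eval (fun j => x j) v) ^ 2 ≤
        ∫ x in prism m ψ, (MvPolynomial.eval (fun j => x j) v) ^ 2 ∧
      ∫ x in prism m ψ, (MvPolynomial.eval (fun j => x j) v) ^ 2 ≤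
        2 * ∫ x in prism m φ, (MvPolynomial.eval (fun j => x j) v) ^ 2 := by
  obtain ⟨_, hφ⟩ := hφLip
  obtain ⟨_, hψ⟩ := hψLip
  have hφ1 := fun y (hy : y ∈ unitCube m) => one_le_of_unitCube_subset_prism hφcube hy
  have hψ1 := fun y (hy : y ∈ unitCube m) => one_le_of_unitCube_subset_prism hψcube hy
  have h1 := setIntegral_prism_le_two_mul hp hφ.continuous hψ.continuous hφ1 hψ1 hclose v hv
  have h2 := setIntegral_prism_le_two_mul hp hψ.continuous hφ.continuous hψ1 hφ1
    (fun y hy => by rw [abs_sub_comm]; exact hclose y hy) v hv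
  exact ⟨by linarith, h1⟩
end
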